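/- Let σ ∈ (∂𝒜₁ ∪ ∂𝒜₂) ∖ {0} and τ₁, τ₂ ∈ 𝕄²ˣ²_sym. If the map z ∈ ℝ² ↦ G(σ + z₁τ₁ + z₂τ₂) is differentiable at z = 0 (i.e., the restriction of G to the affine plane 𝒯 := {σ + z₁τ₁ + z₂τ₂ : z ∈ ℝ²} is differentiable at σ), then τ₁ : ν(σ) = 0 and τ₂ : ν(σ) = 0. -/

import Mathlib

open Matrix Set
open scoped Classical

attribute [local instance] Matrix.frobeniusNormedAddCommGroup Matrix.frobeniusNormedSpace

noncomputable section

/-- The space of real 2×2 matrices (symmetric ones are singled out by `Matrix.IsSymm`). -/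
abbrev M2 : Type := Matrix (Fin 2) (Fin 2) ℝ

/-- Frobenius inner product `A : B = tr (Aᵀ B)`. -/
def inn (A B : M2) : ℝ := (Aᵀ * B).trace

/-- Frobenius norm `|A| = √(A : A)`. -/
def fnorm (A : M2) : ℝ := Real.sqrt (inn A A)

/-- Deviatoric part `A_D = A − (tr A / 2) Id`. -/
def dev (A : M2) : M2 := A - (A.trace / 2) • (1 : M2)

/-- The set of symmetric matrices `𝕄²ˣ²_sym`. -/
def Msym : Set M2 := {A | A.IsSymm}

/-- The Drucker–Prager elasticity set `K = {σ ∈ 𝕄²ˣ²_sym : |σ_D| + α tr σ ≤ κ}`. -/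
def Kset (α κ : ℝ) : Set M2 :=
  {σ | σ.IsSymm ∧ fnorm (dev σ) + α * σ.trace ≤ κ}

/-- The isotropic elasticity tensor `ℂ e = λ (tr e) Id + 2 μ e`. -/
def Cc (lam mu : ℝ) (e : M2) : M2 := (lam * e.trace) • (1 : M2) + (2 * mu) • e

/-- The inverse elasticity tensor `ℂ⁻¹ σ = (tr σ / (4 K₀)) Id + (1/(2μ)) σ_D`, `K₀ = λ + μ`. -/
def Cinv (lam mu : ℝ) (σ : M2) : M2 :=
  (σ.trace / (4 * (lam + mu))) • (1 : M2) + (1 / (2 * mu)) • dev σ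

/-- The constant `β = (1/μ + 1/(2 α² K₀))⁻¹`. -/
def betaC (α lam mu : ℝ) : ℝ := (1 / mu + 1 / (2 * α ^ 2 * (lam + mu)))⁻¹

/-- The function `g`. -/
def gfun (α κ lam mu : ℝ) (ξ : M2) : ℝ :=
  if 2 * mu * fnorm (dev ξ) + 2 * α * (lam + mu) * ξ.trace ≤ κ then
    ((lam + mu) / 2) * ξ.trace ^ 2 + mu * fnorm (dev ξ) ^ 2
  else
    κ * ξ.trace / (2 * α) - κ ^ 2 / (8 * α ^ 2 * (lam + mu)) +
      betaC α lam mu *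
        max (fnorm (dev ξ) - ξ.trace / (2 * α) + κ / (4 * α ^ 2 * (lam + mu))) 0 ^ 2

/-- The (matrix representing the) differential of `g`. -/
def Dg (α κ lam mu : ℝ) (ξ : M2) : M2 :=
  if 2 * mu * fnorm (dev ξ) + 2 * α * (lam + mu) * ξ.trace ≤ κ then
    ((lam + mu) * ξ.trace) • (1 : M2) + (2 * mu) • dev ξ
  else
    (κ / (2 * α)) • (1 : M2) +
      (2 * betaC α lam mu *
          max (fnorm (dev ξ) - ξ.trace / (2 * α) + κ / (4 * α ^ 2 * (lam + mu))) 0) •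
        ((fnorm (dev ξ))⁻¹ • dev ξ - (1 / (2 * α)) • (1 : M2))

/-- The open cone `𝒜₁ = {ξ ∈ 𝕄²ˣ²_sym : μ |ξ_D| + α K₀ tr ξ < 0}`. -/
def A1 (α lam mu : ℝ) : Set M2 :=
  {ξ | ξ.IsSymm ∧ mu * fnorm (dev ξ) + α * (lam + mu) * ξ.trace < 0}

/-- The open cone `𝒜₂ = {ξ ∈ 𝕄²ˣ²_sym : |ξ_D| < tr ξ / (2α)}`. -/
def A2 (α : ℝ) : Set M2 :=
  {ξ | ξ.IsSymm ∧ fnorm (dev ξ) < ξ.trace / (2 * α)}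

/-- The cone `𝒜₃ = 𝕄²ˣ²_sym ∖ (cl 𝒜₁ ∪ cl 𝒜₂)`. -/
def A3 (α lam mu : ℝ) : Set M2 :=
  Msym \ (closure (A1 α lam mu) ∪ closure (A2 α))

/-- The function `G(ξ) = Dg(ξ + (κ/(4αK₀)) Id)`, given by its explicit piecewise expression. -/
def Gfun (α κ lam mu : ℝ) (ξ : M2) : M2 :=
  if ξ ∈ A1 α lam mu then
    (κ / (2 * α)) • (1 : M2) + ((lam + mu) * ξ.trace) • (1 : M2) + (2 * mu) • dev ξ
  else if ξ ∈ A2 α ∨ ξ = 0 then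
    (κ / (2 * α)) • (1 : M2)
  else
    (κ / (2 * α)) • (1 : M2) +
      (2 * betaC α lam mu * (fnorm (dev ξ) - ξ.trace / (2 * α))) •
        ((fnorm (dev ξ))⁻¹ • dev ξ - (1 / (2 * α)) • (1 : M2))

/-- The map `𝒢(ξ, η)`. -/
def calG (α lam mu : ℝ) (ξ η : M2) : M2 :=
  if ξ ∈ A1 α lam mu then
    ((lam + mu) * η.trace) • (1 : M2) + (2 * mu) • dev η
  else if ξ ∈ A2 α ∨ ξ = 0 then
    0
  else
    (2 * betaC α lam mu * (inn (dev ξ) (dev η) / fnorm (dev ξ) - η.trace / (2 * α))) •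
      ((fnorm (dev ξ))⁻¹ • dev ξ - (1 / (2 * α)) • (1 : M2)) +
    (2 * betaC α lam mu * (fnorm (dev ξ) - ξ.trace / (2 * α)) * (fnorm (dev ξ))⁻¹) •
      (dev η - (inn (dev ξ) (dev η) / fnorm (dev ξ) ^ 2) • dev ξ)

/-- The relative boundary `∂𝒜₁` of `𝒜₁` inside `𝕄²ˣ²_sym`. -/
def bdryA1 (α lam mu : ℝ) : Set M2 := closure (A1 α lam mu) \ A1 α lam mu

/-- The relative boundary `∂𝒜₂` of `𝒜₂` inside `𝕄²ˣ²_sym`. -/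
def bdryA2 (α : ℝ) : Set M2 := closure (A2 α) \ A2 α

/-- The outward normal `ν(σ) = μ σ_D/|σ_D| + α K₀ Id` for `σ ∈ ∂𝒜₁ ∖ {0}`. -/
def nu1 (α lam mu : ℝ) (σ : M2) : M2 :=
  (mu * (fnorm (dev σ))⁻¹) • dev σ + (α * (lam + mu)) • (1 : M2)

/-- The outward normal `ν(σ) = σ_D/|σ_D| − (1/(2α)) Id` for `σ ∈ ∂𝒜₂ ∖ {0}`. -/
def nu2 (α : ℝ) (σ : M2) : M2 :=
  (fnorm (dev σ))⁻¹ • dev σ - (1 / (2 * α)) • (1 : M2)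

lemma inn_eq_sum (A B : M2) :
    inn A B = A 0 0 * B 0 0 + A 1 0 * B 1 0 + A 0 1 * B 0 1 + A 1 1 * B 1 1 := by
  simp [inn, Matrix.trace, Matrix.mul_apply, Fin.sum_univ_two]
  ring

lemma inn_self_nonneg (A : M2) : 0 ≤ inn A A := by
  rw [inn_eq_sum]
  nlinarith [mul_self_nonneg (A 0 0), mul_self_nonneg (A 1 0), mul_self_nonneg (A 0 1),
    mul_self_nonneg (A 1 1)]

lemma eq_zero_of_inn_self_eq_zero {A : M2} (h : inn A A = 0) : A = 0 := by
  rw [inn_eq_sum] at h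
  ext i j
  fin_cases i <;> fin_cases j <;> simp <;> nlinarith

lemma eq_zero_of_fnorm_eq_zero {A : M2} (h : fnorm A = 0) : A = 0 :=
  eq_zero_of_inn_self_eq_zero ((Real.sqrt_eq_zero (inn_self_nonneg A)).1 h)

lemma trace_dev (A : M2) : (dev A).trace = 0 := by
  simp [dev, Matrix.trace, Fin.sum_univ_two]
  ring

lemma continuous_trace : Continuous fun A : M2 => A.trace :=
  Continuous.matrix_trace continuous_id

lemma continuous_fnorm_dev : Continuous fun A : M2 => fnorm (dev A) := by
  unfold fnorm inn dev
  have h : Continuous fun A : M2 => A - (A.trace / 2) • (1 : M2) :=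
    continuous_id.sub ((continuous_trace.div_const 2).smul continuous_const)
  exact Real.continuous_sqrt.comp (h.matrix_transpose.matrix_mul h).matrix_trace

lemma isClosed_Msym : IsClosed Msym :=
  isClosed_eq continuous_id.matrix_transpose continuous_id

lemma mem_bdryA1 {α lam mu : ℝ} {σ : M2} (h : σ ∈ bdryA1 α lam mu) :
    σ.IsSymm ∧ mu * fnorm (dev σ) + α * (lam + mu) * σ.trace = 0 := by
  have hc : IsClosed {ξ : M2 | ξ ∈ Msym ∧
      mu * fnorm (dev ξ) + α * (lam + mu) * ξ.trace ≤ 0} :=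
    isClosed_Msym.inter (isClosed_le ((continuous_const.mul continuous_fnorm_dev).add
      (continuous_const.mul continuous_trace)) continuous_const)
  have hsub : A1 α lam mu ⊆ {ξ : M2 | ξ ∈ Msym ∧
      mu * fnorm (dev ξ) + α * (lam + mu) * ξ.trace ≤ 0} := fun ξ hξ => ⟨hξ.1, hξ.2.le⟩
  have hs := closure_minimal hsub hc h.1
  exact ⟨hs.1, hs.2.antisymm (not_lt.1 fun hlt => h.2 ⟨hs.1, hlt⟩)⟩

lemma mem_bdryA2 {α : ℝ} {σ : M2} (h : σ ∈ bdryA2 α) :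
    σ.IsSymm ∧ fnorm (dev σ) - σ.trace / (2 * α) = 0 := by
  have hc : IsClosed {ξ : M2 | ξ ∈ Msym ∧ fnorm (dev ξ) ≤ ξ.trace / (2 * α)} :=
    isClosed_Msym.inter (isClosed_le continuous_fnorm_dev (continuous_trace.div_const _))
  have hsub : A2 α ⊆ {ξ : M2 | ξ ∈ Msym ∧ fnorm (dev ξ) ≤ ξ.trace / (2 * α)} :=
    fun ξ hξ => ⟨hξ.1, hξ.2.le⟩
  have hs := closure_minimal hsub hc h.1
  exact ⟨hs.1, sub_eq_zero.2 (hs.2.antisymm (not_lt.1 fun hlt => h.2 ⟨hs.1, hlt⟩))⟩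

/-- If the positive part of a function is differentiable at a zero of the function, then the
derivative of the function vanishes there. -/
lemma deriv_eq_zero_of_differentiableAt_posPart {h : ℝ → ℝ} {a x : ℝ} (hd : HasDerivAt h a x)
    (h0 : h x = 0) (hm : DifferentiableAt ℝ (fun t => max (h t) 0) x) : a = 0 := by
  have h1 : deriv (fun t => max (h t) 0) x = 0 := by
    apply IsLocalMin.deriv_eq_zero
    exact Filter.Eventually.of_forall fun t => by simp [h0]
  have h2 := hm.hasDerivAt.sub hd
  have h3 : IsLocalMin ((fun t => max (h t) 0) - h) x :=
    Filter.Eventually.of_forall fun t => by simp [h0]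
  have := h3.hasDerivAt_eq_zero h2
  linarith

lemma hasDerivAt_trace_line (σ τ : M2) :
    HasDerivAt (fun t : ℝ => (σ + t • τ).trace) τ.trace 0 := by
  simp only [Matrix.trace_add, Matrix.trace_smul, smul_eq_mul]
  simpa using ((hasDerivAt_id (0 : ℝ)).mul_const τ.trace).const_add σ.trace

lemma hasDerivAt_fnorm_dev_line (σ τ : M2) (hσ : fnorm (dev σ) ≠ 0) :
    HasDerivAt (fun t : ℝ => fnorm (dev (σ + t • τ)))
      ((fnorm (dev σ))⁻¹ * inn τ (dev σ)) 0 := by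
  have hq : ∀ t : ℝ, inn (dev (σ + t • τ)) (dev (σ + t • τ)) =
      inn (dev σ) (dev σ) + t * (2 * inn τ (dev σ)) + t ^ 2 * inn (dev τ) (dev τ) := by
    intro t
    simp [inn_eq_sum, dev, Matrix.trace, Fin.sum_univ_two]
    ring
  have hi : inn (dev σ) (dev σ) ≠ 0 := fun h => hσ (by simp [fnorm, h])
  unfold fnorm at *
  simp only [hq]
  have h1 : HasDerivAt (fun t : ℝ => inn (dev σ) (dev σ) + t * (2 * inn τ (dev σ)) +
      t ^ 2 * inn (dev τ) (dev τ)) (2 * inn τ (dev σ)) 0 := by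
    have h2 := (((hasDerivAt_id (0 : ℝ)).mul_const (2 * inn τ (dev σ))).const_add
      (inn (dev σ) (dev σ))).add (((hasDerivAt_id (0 : ℝ)).pow 2).mul_const (inn (dev τ) (dev τ)))
    refine HasDerivAt.congr_deriv h2 ?_
    simp
  convert h1.sqrt (by simpa using hi) using 1
  simp
  field_simp

lemma inn_nu1 (α lam mu : ℝ) (σ τ : M2) : inn τ (nu1 α lam mu σ) =
    mu * ((fnorm (dev σ))⁻¹ * inn τ (dev σ)) + α * (lam + mu) * τ.trace := by
  simp [inn_eq_sum, nu1, Matrix.trace, Fin.sum_univ_two]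
  ring

lemma inn_nu2 (α : ℝ) (σ τ : M2) : inn τ (nu2 α σ) =
    (fnorm (dev σ))⁻¹ * inn τ (dev σ) - τ.trace / (2 * α) := by
  simp [inn_eq_sum, nu2, Matrix.trace, Fin.sum_univ_two]
  ring

lemma eq_zero_of_fnorm_dev_of_trace {σ : M2} (hd : fnorm (dev σ) = 0) (ht : σ.trace = 0) :
    σ = 0 := by
  simpa [dev, ht] using eq_zero_of_fnorm_eq_zero hd

lemma fnorm_nonneg (A : M2) : 0 ≤ fnorm A := Real.sqrt_nonneg _

lemma trace_Gfun_of_trace_pos {α κ lam mu : ℝ} (hα : 0 < α) (hmu : 0 < mu) (hlm : 0 < lam + mu)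
    {ξ : M2} (hs : ξ.IsSymm) (ht : 0 < ξ.trace) :
    (Gfun α κ lam mu ξ).trace =
      κ / α - 2 * betaC α lam mu / α * max (fnorm (dev ξ) - ξ.trace / (2 * α)) 0 := by
  have h1 : ξ ∉ A1 α lam mu := fun h => by
    have h2 := h.2
    have := mul_nonneg hmu.le (fnorm_nonneg (dev ξ))
    have : 0 < α * (lam + mu) * ξ.trace := by positivity
    linarith
  have h0 : ξ ≠ 0 := by rintro rfl; simp at ht
  rw [Gfun, if_neg h1]
  by_cases h2 : ξ ∈ A2 α
  · rw [if_pos (Or.inl h2), max_eq_right (sub_nonpos.2 h2.2.le)]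
    simp
    field_simp
  · have h3 : 0 ≤ fnorm (dev ξ) - ξ.trace / (2 * α) :=
      sub_nonneg.2 (not_lt.1 fun h => h2 ⟨hs, h⟩)
    rw [if_neg (by tauto), max_eq_left h3]
    simp [trace_dev]
    field_simp
    ring

lemma trace_Gfun_of_trace_neg {α κ lam mu : ℝ} (hα : 0 < α) (hmu : 0 < mu) (hlm : 0 < lam + mu)
    {ξ : M2} (hs : ξ.IsSymm) (ht : ξ.trace < 0) :
    (Gfun α κ lam mu ξ).trace = κ / α + 2 * (lam + mu) * ξ.trace -
      4 * α * (lam + mu) / (2 * α ^ 2 * (lam + mu) + mu) *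
        max (mu * fnorm (dev ξ) + α * (lam + mu) * ξ.trace) 0 := by
  have h0 : ξ ≠ 0 := by rintro rfl; simp at ht
  have h2 : ξ ∉ A2 α := fun h => by
    have := h.2
    have := fnorm_nonneg (dev ξ)
    have : ξ.trace / (2 * α) < 0 := div_neg_of_neg_of_pos ht (by positivity)
    linarith
  rw [Gfun]
  by_cases h1 : ξ ∈ A1 α lam mu
  · rw [if_pos h1, max_eq_right h1.2.le]
    simp [trace_dev]
    field_simp
  · have h3 : 0 ≤ mu * fnorm (dev ξ) + α * (lam + mu) * ξ.trace :=
      not_lt.1 fun h => h1 ⟨hs, h⟩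
    have hβ : betaC α lam mu =
        2 * α ^ 2 * (lam + mu) * mu / (2 * α ^ 2 * (lam + mu) + mu) := by
      rw [betaC, ← _root_.inv_inj, inv_inv, inv_div]
      generalize lam + mu = K at *
      field_simp
    rw [if_neg h1, if_neg (by tauto), max_eq_left h3, hβ]
    simp [trace_dev]
    generalize lam + mu = K at *
    field_simp
    ring

lemma inn_nu_of_differentiableAt_line {α κ lam mu : ℝ} (hα : 0 < α) (hmu : 0 < mu)
    (hlm : 0 < lam + mu) {σ τ : M2} (hσ0 : σ ≠ 0) (hτ : τ.IsSymm)
    (hdiff : DifferentiableAt ℝ (fun t : ℝ => Gfun α κ lam mu (σ + t • τ)) 0) :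
    (σ ∈ bdryA1 α lam mu → inn τ (nu1 α lam mu σ) = 0) ∧
    (σ ∈ bdryA2 α → inn τ (nu2 α σ) = 0) := by
  have hG : DifferentiableAt ℝ (fun t : ℝ => (Gfun α κ lam mu (σ + t • τ)).trace) 0 :=
    (LinearMap.toContinuousLinearMap (Matrix.traceLinearMap (Fin 2) ℝ ℝ)).differentiableAt.comp
      (0 : ℝ) hdiff
  have hsymm (hσ : σ.IsSymm) (t : ℝ) : (σ + t • τ).IsSymm := hσ.add (hτ.smul t)
  have htr := hasDerivAt_trace_line σ τ
  constructor
  · intro hσ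
    obtain ⟨hs, hz⟩ := mem_bdryA1 hσ
    have hr : fnorm (dev σ) ≠ 0 := fun h => hσ0 <| eq_zero_of_fnorm_dev_of_trace h <| by
      simpa [h, hα.ne', hlm.ne'] using hz
    have hneg : σ.trace < 0 := by
      have := mul_pos hmu ((fnorm_nonneg (dev σ)).lt_of_ne' hr)
      have := mul_pos hα hlm
      nlinarith
    rw [inn_nu1]
    refine deriv_eq_zero_of_differentiableAt_posPart
      (((hasDerivAt_fnorm_dev_line σ τ hr).const_mul mu).add (htr.const_mul (α * (lam + mu))))
      (by simpa using hz) ?_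
    have hC : 4 * α * (lam + mu) / (2 * α ^ 2 * (lam + mu) + mu) ≠ 0 := by positivity
    have hD := (((htr.differentiableAt.const_mul (2 * (lam + mu))).const_add (κ / α)).sub
      hG).const_mul (4 * α * (lam + mu) / (2 * α ^ 2 * (lam + mu) + mu))⁻¹
    refine hD.congr_of_eventuallyEq ?_
    filter_upwards [htr.continuousAt.eventually_lt_const (by simpa using hneg)] with t ht
    simp only [Pi.sub_apply, Pi.add_apply, trace_Gfun_of_trace_neg hα hmu hlm (hsymm hs t) ht,
      sub_sub_cancel, inv_mul_cancel_left₀ hC]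
  · intro hσ
    obtain ⟨hs, hz⟩ := mem_bdryA2 hσ
    have hr : fnorm (dev σ) ≠ 0 := fun h => hσ0 <| eq_zero_of_fnorm_dev_of_trace h <| by
      simpa [h, hα.ne'] using hz
    have hpos : 0 < σ.trace := by
      have h1 := (fnorm_nonneg (dev σ)).lt_of_ne' hr
      rw [sub_eq_zero.1 hz] at h1
      exact (div_pos_iff_of_pos_right (by positivity)).1 h1
    rw [inn_nu2]
    refine deriv_eq_zero_of_differentiableAt_posPart
      ((hasDerivAt_fnorm_dev_line σ τ hr).sub (htr.div_const (2 * α)))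
      (by simpa using hz) ?_
    have hC : 2 * betaC α lam mu / α ≠ 0 := by unfold betaC; positivity
    have hD := (hG.const_sub (κ / α)).const_mul (2 * betaC α lam mu / α)⁻¹
    refine hD.congr_of_eventuallyEq ?_
    filter_upwards [htr.continuousAt.eventually_const_lt (by simpa using hpos)] with t ht
    simp only [Pi.sub_apply, trace_Gfun_of_trace_pos hα hmu hlm (hsymm hs t) ht,
      sub_sub_cancel, inv_mul_cancel_left₀ hC]

/-- If `σ ∈ (∂𝒜₁ ∪ ∂𝒜₂) ∖ {0}` and the restriction of `G` to the affine
plane `{σ + z₁τ₁ + z₂τ₂}` is differentiable at `σ`, then `τ₁ : ν(σ) = 0` and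
`τ₂ : ν(σ) = 0`. -/
theorem stmt_17 (α κ lam mu : ℝ) (hα : 0 < α) (hκ : 0 < κ) (hmu : 0 < mu)
    (hlm : 0 < lam + mu) (σ τ₁ τ₂ : M2)
    (hσ : σ ∈ bdryA1 α lam mu ∪ bdryA2 α) (hσ0 : σ ≠ 0)
    (hτ₁ : τ₁.IsSymm) (hτ₂ : τ₂.IsSymm)
    (hdiff : DifferentiableAt ℝ
      (fun z : ℝ × ℝ => Gfun α κ lam mu (σ + z.1 • τ₁ + z.2 • τ₂)) 0) :
    (σ ∈ bdryA1 α lam mu →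
      inn τ₁ (nu1 α lam mu σ) = 0 ∧ inn τ₂ (nu1 α lam mu σ) = 0) ∧
    (σ ∈ bdryA2 α →
      inn τ₁ (nu2 α σ) = 0 ∧ inn τ₂ (nu2 α σ) = 0) := by
  have h1 : DifferentiableAt ℝ (fun t : ℝ => Gfun α κ lam mu (σ + t • τ₁)) 0 := by
    have hl : DifferentiableAt ℝ (fun t : ℝ => ((t, 0) : ℝ × ℝ)) 0 := by fun_prop
    exact (DifferentiableAt.comp (0 : ℝ) (by exact hdiff) hl).congr_of_eventuallyEq
      (Filter.Eventually.of_forall fun t => by simp)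
  have h2 : DifferentiableAt ℝ (fun t : ℝ => Gfun α κ lam mu (σ + t • τ₂)) 0 := by
    have hl : DifferentiableAt ℝ (fun t : ℝ => ((0, t) : ℝ × ℝ)) 0 := by fun_prop
    exact (DifferentiableAt.comp (0 : ℝ) (by exact hdiff) hl).congr_of_eventuallyEq
      (Filter.Eventually.of_forall fun t => by simp)
  have k1 := inn_nu_of_differentiableAt_line hα hmu hlm hσ0 hτ₁ h1
  have k2 := inn_nu_of_differentiableAt_line hα hmu hlm hσ0 hτ₂ h2
  exact ⟨fun h => ⟨k1.1 h, k2.1 h⟩, fun h => ⟨k1.2 h, k2.2 h⟩⟩
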